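/- Fix x ∈ R^n with x ≥ 0 such that rank(F^⊤ Diag(x) F) ≥ s. Then the map Υ ↦ f_DDFact(x;Υ) is differentiable at every Υ ∈ R^n_{++} with gradient g_Υ(x;Υ) = x ∘ diag(F Q Diag(β) Q^⊤ F^⊤) − Diag(Υ)^{-1} x, where F_DDFact(x;Υ) = Q Diag(λ) Q^⊤ is a spectral decomposition with Q orthonormal and λ decreasingly ordered, and β ∈ R^k is given by β_i = 1/λ_i for i ≤ ι and β_i = (s−ι)/Σ_{ℓ=ι+1}^k λ_ℓ for i > ι, ι being the unique integer of Lemma 1 for λ; moreover g_Υ(x;Υ) does not depend on the choice of F or Q (with β adjusted accordingly). (Theorem 3.iv, first part) -/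

import Mathlib

open Matrix
open scoped Matrix BigOperators Classical

noncomputable section

/-- `(1/(s−ι)) Σ_{ℓ=ι+1}^k λ_ℓ` (eigenvalues indexed from `1`). -/
def avgTail (k s : ℕ) (lam : ℕ → ℝ) (ι : ℕ) : ℝ :=
  (∑ ℓ ∈ Finset.Icc (ι + 1) k, lam ℓ) / ((s : ℝ) - ι)

/-- The defining property of the unique index `ι` of Lemma 1
(with the convention `λ_0 = +∞`, so for `ι = 0` the left inequality is vacuous). -/
def IsIota (k s : ℕ) (lam : ℕ → ℝ) (ι : ℕ) : Prop :=
  ι < s ∧ (1 ≤ ι → avgTail k s lam ι < lam ι) ∧ lam (ι + 1) ≤ avgTail k s lam ι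

/-- The unique index `ι` of Lemma 1 (junk value `0` if no such index exists). -/
def iotaOf (k s : ℕ) (lam : ℕ → ℝ) : ℕ :=
  if h : ∃ ι, IsIota k s lam ι then h.choose else 0

/-- `φ_s(λ) = Σ_{ℓ=1}^ι log λ_ℓ + (s−ι) log((1/(s−ι)) Σ_{ℓ=ι+1}^k λ_ℓ)`. -/
def phiS (k s : ℕ) (lam : ℕ → ℝ) : ℝ :=
  (∑ ℓ ∈ Finset.Icc 1 (iotaOf k s lam), Real.log (lam ℓ)) +
    ((s : ℝ) - iotaOf k s lam) * Real.log (avgTail k s lam (iotaOf k s lam))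

/-- The decreasingly ordered eigenvalues of a symmetric matrix, indexed from `1`
(junk value `0` outside `[1,k]` or if `X` is not Hermitian). -/
def eigsDesc (k : ℕ) (X : Matrix (Fin k) (Fin k) ℝ) : ℕ → ℝ := fun i =>
  if h : X.IsHermitian then
    ((((List.ofFn h.eigenvalues : List ℝ) : Multiset ℝ).sort (· ≤ ·)).reverse).getD (i - 1) 0
  else 0

/-- `Γ_s(X) = φ_s(λ(X))` with `λ(X)` the decreasingly ordered eigenvalues of `X`. -/
def gammaS (k s : ℕ) (X : Matrix (Fin k) (Fin k) ℝ) : ℝ :=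
  phiS k s (eigsDesc k X)

/-- `F_DDFact(x;Υ) = Fᵀ Diag(Υ∘x) F = Σ_i γ_i x_i F_{i·}ᵀ F_{i·}`. -/
def FDD (n k : ℕ) (F : Matrix (Fin n) (Fin k) ℝ) (x Υ : Fin n → ℝ) :
    Matrix (Fin k) (Fin k) ℝ :=
  Fᵀ * Matrix.diagonal (fun i => Υ i * x i) * F

/-- `f_DDFact(x;Υ) = Γ_s(F_DDFact(x;Υ)) − Σ_i x_i log γ_i`. -/
def fDD (n k s : ℕ) (F : Matrix (Fin n) (Fin k) ℝ) (x Υ : Fin n → ℝ) : ℝ :=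
  gammaS k s (FDD n k F x Υ) - ∑ i, x i * Real.log (Υ i)

/-- `β` of Definition 1: `β_i = 1/λ_i` for `i ≤ ι` and
`β_i = (s−ι)/Σ_{ℓ=ι+1}^k λ_ℓ` for `i > ι` (here `β` is indexed by `Fin k`, `j ↔ j+1`). -/
def betaOf (k s : ℕ) (lam : ℕ → ℝ) : Fin k → ℝ := fun j =>
  if (j : ℕ) + 1 ≤ iotaOf k s lam then (lam ((j : ℕ) + 1))⁻¹
  else ((s : ℝ) - iotaOf k s lam) / ∑ ℓ ∈ Finset.Icc (iotaOf k s lam + 1) k, lam ℓ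

/-- `F Q Diag(β) Qᵀ Fᵀ`, whose diagonal appears in the (generalized) gradients. -/
def gMat (n k s : ℕ) (F : Matrix (Fin n) (Fin k) ℝ) (Q : Matrix (Fin k) (Fin k) ℝ)
    (lam : ℕ → ℝ) : Matrix (Fin n) (Fin n) ℝ :=
  F * Q * Matrix.diagonal (betaOf k s lam) * Qᵀ * Fᵀ

/-- `Q, λ` form a spectral decomposition of `F_DDFact(x;Υ)` as in Definition 1:
`Q` orthonormal and `F_DDFact(x;Υ) = Q Diag(λ) Qᵀ` with `λ` decreasing and nonnegative
(indexed from `1`). -/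
def IsSpectralDecomp (n k : ℕ) (F : Matrix (Fin n) (Fin k) ℝ) (x Υ : Fin n → ℝ)
    (Q : Matrix (Fin k) (Fin k) ℝ) (lam : ℕ → ℝ) : Prop :=
  Q * Qᵀ = 1 ∧
  FDD n k F x Υ = Q * Matrix.diagonal (fun j : Fin k => lam ((j : ℕ) + 1)) * Qᵀ ∧
  (∀ i, 0 ≤ lam i) ∧
  (∀ i j, 1 ≤ i → i ≤ j → j ≤ k → lam j ≤ lam i)

/-- Euclidean (2-)norm of a vector in `ℝⁿ`. -/
def enorm2 (n : ℕ) (v : Fin n → ℝ) : ℝ :=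
  Real.sqrt (∑ i, (v i) ^ 2)

/-- `t` is the largest root of `∑ j, min (μ j) t = s * t`, and it is positive. -/
structure IsWaterLevel {k : ℕ} (s : ℕ) (μ : Fin k → ℝ) (t : ℝ) : Prop where
  pos : 0 < t
  sum_min : ∑ j, min (μ j) t = s * t
  le_of_le_sum : ∀ u, s * u ≤ ∑ j, min (μ j) u → u ≤ t

/-- The symmetric expression of `φ_s` through the water level `t`. -/
def levelLog {k : ℕ} (μ : Fin k → ℝ) (t : ℝ) : ℝ :=
  ∑ j, min (μ j) t / t * Real.log (max (μ j) t)

lemma sum_Icc_eq_sum_fin (k : ℕ) (f : ℕ → ℝ) :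
    ∑ ℓ ∈ Finset.Icc 1 k, f ℓ = ∑ j : Fin k, f ((j : ℕ) + 1) := by
  rw [Fin.sum_univ_eq_sum_range (fun i => f (i + 1)), Finset.range_eq_Ico,
    Finset.sum_Ico_add' f 0 k 1]
  rfl

lemma sum_Icc_split {k ι : ℕ} (h : ι ≤ k) (f : ℕ → ℝ) :
    ∑ ℓ ∈ Finset.Icc 1 k, f ℓ =
      ∑ ℓ ∈ Finset.Icc 1 ι, f ℓ + ∑ ℓ ∈ Finset.Icc (ι + 1) k, f ℓ := by
  have h1 : ∀ a b : ℕ, Finset.Icc (a + 1) b = Finset.Ioc a b := fun a b =>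
    Finset.Icc_add_one_left_eq_Ioc a b
  rw [h1 ι k, ← zero_add 1, h1 0 ι, h1 0 k, Finset.sum_Ioc_consecutive f (Nat.zero_le ι) h]

lemma exists_isIota {k s : ℕ} (hs : 0 < s) (hsk : s ≤ k) {lam : ℕ → ℝ}
    (h0 : ∀ i, 0 ≤ lam i) : ∃ ι, IsIota k s lam ι := by
  have hex : ∃ ι, ι < s ∧ lam (ι + 1) ≤ avgTail k s lam ι := by
    refine ⟨s - 1, by omega, ?_⟩
    have h1 : (s : ℝ) - ((s - 1 : ℕ) : ℝ) = 1 := by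
      rw [Nat.cast_sub hs]; simp
    rw [avgTail, h1, div_one]
    exact Finset.single_le_sum (f := lam) (fun i _ => h0 i)
      (Finset.mem_Icc.2 ⟨le_rfl, by omega⟩)
  refine ⟨Nat.find hex, (Nat.find_spec hex).1, fun h1 => ?_, (Nat.find_spec hex).2⟩
  have hlt := (Nat.find_spec hex).1
  have hm := Nat.find_min hex (m := Nat.find hex - 1) (by omega)
  generalize Nat.find hex = ι at *
  obtain ⟨m, rfl⟩ : ∃ m, ι = m + 1 := ⟨ι - 1, by omega⟩
  simp only [Nat.add_sub_cancel, not_and, not_le] at hm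
  have hm := hm (by omega)
  have hms : (m : ℝ) + 1 < s := by exact_mod_cast hlt
  unfold avgTail at *
  rw [← Finset.add_sum_Ioc_eq_sum_Icc (by omega : m + 1 ≤ k),
    div_lt_iff₀ (by linarith)] at hm
  rw [← Finset.Icc_add_one_left_eq_Ioc] at hm
  push_cast
  rw [div_lt_iff₀ (by linarith)]
  nlinarith

lemma isIota_iotaOf {k s : ℕ} (hs : 0 < s) (hsk : s ≤ k) {lam : ℕ → ℝ}
    (h0 : ∀ i, 0 ≤ lam i) : IsIota k s lam (iotaOf k s lam) := by
  have h := exists_isIota hs hsk h0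
  rw [iotaOf, dif_pos h]
  exact h.choose_spec

/-- A decreasing nonnegative sequence on `[1,k]` with at least `s` nonzero entries. -/
structure IsSortedSpectrum (k s : ℕ) (lam : ℕ → ℝ) : Prop where
  nonneg : ∀ i, 0 ≤ lam i
  anti : ∀ i j, 1 ≤ i → i ≤ j → j ≤ k → lam j ≤ lam i
  le_card : (s : ℝ) ≤ ∑ j : Fin k, if lam ((j : ℕ) + 1) ≠ 0 then (1 : ℝ) else 0

namespace IsSortedSpectrum

variable {k s : ℕ} {lam : ℕ → ℝ}

lemma le_size (h : IsSortedSpectrum k s lam) : s ≤ k := by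
  have : ∑ j : Fin k, (if lam ((j : ℕ) + 1) ≠ 0 then (1 : ℝ) else 0) ≤ ∑ _j : Fin k, 1 :=
    Finset.sum_le_sum fun j _ => by split_ifs <;> norm_num
  simp only [Finset.sum_const, Finset.card_univ, Fintype.card_fin, nsmul_eq_mul, mul_one] at this
  exact_mod_cast h.le_card.trans this

lemma pos (h : IsSortedSpectrum k s lam) (hs : 0 < s) : 0 < lam s := by
  have hsk := h.le_size
  have hcard := h.le_card
  refine (h.nonneg s).lt_of_ne fun hz => ?_
  rw [← sum_Icc_eq_sum_fin k (fun ℓ => if lam ℓ ≠ 0 then (1 : ℝ) else 0),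
    sum_Icc_split (by omega : s - 1 ≤ k)] at hcard
  have h1 : ∑ ℓ ∈ Finset.Icc 1 (s - 1), (if lam ℓ ≠ 0 then (1 : ℝ) else 0) ≤
      ∑ _ℓ ∈ Finset.Icc 1 (s - 1), 1 :=
    Finset.sum_le_sum fun j _ => by split_ifs <;> norm_num
  have h2 : ∑ ℓ ∈ Finset.Icc (s - 1 + 1) k, (if lam ℓ ≠ 0 then (1 : ℝ) else 0) = 0 := by
    refine Finset.sum_eq_zero fun ℓ hℓ => if_neg (not_not.2 ?_)
    rw [Finset.mem_Icc] at hℓ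
    exact le_antisymm (hz ▸ h.anti s ℓ (by omega) (by omega) hℓ.2) (h.nonneg ℓ)
  simp only [Finset.sum_const, Nat.card_Icc, nsmul_eq_mul, mul_one, Nat.add_sub_cancel] at h1
  have h3 : (s : ℝ) ≤ ((s - 1 : ℕ) : ℝ) := by linarith
  have : s ≤ s - 1 := by exact_mod_cast h3
  omega

lemma isIota (h : IsSortedSpectrum k s lam) (hs : 0 < s) : IsIota k s lam (iotaOf k s lam) :=
  isIota_iotaOf hs h.le_size h.nonneg

lemma avgTail_pos (h : IsSortedSpectrum k s lam) (hs : 0 < s) :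
    0 < avgTail k s lam (iotaOf k s lam) := by
  obtain ⟨h1, -, h3⟩ := h.isIota hs
  exact ((h.pos hs).trans_le (h.anti _ _ (by omega) (by omega) h.le_size)).trans_le h3

lemma avgTail_lt (h : IsSortedSpectrum k s lam) (hs : 0 < s) {ℓ : ℕ} (h1 : 1 ≤ ℓ)
    (h2 : ℓ ≤ iotaOf k s lam) : avgTail k s lam (iotaOf k s lam) < lam ℓ := by
  obtain ⟨h3, h4, -⟩ := h.isIota hs
  have := h.le_size
  exact (h4 (by omega)).trans_le (h.anti _ _ h1 h2 (by omega))

lemma le_avgTail (h : IsSortedSpectrum k s lam) (hs : 0 < s) {ℓ : ℕ}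
    (h1 : iotaOf k s lam + 1 ≤ ℓ) (h2 : ℓ ≤ k) : lam ℓ ≤ avgTail k s lam (iotaOf k s lam) :=
  (h.anti _ _ (by omega) h1 h2).trans (h.isIota hs).2.2

lemma sum_tail (h : IsSortedSpectrum k s lam) (hs : 0 < s) :
    ∑ ℓ ∈ Finset.Icc (iotaOf k s lam + 1) k, lam ℓ =
      ((s : ℝ) - iotaOf k s lam) * avgTail k s lam (iotaOf k s lam) := by
  have h1 : (iotaOf k s lam : ℝ) < s := by exact_mod_cast (h.isIota hs).1
  rw [avgTail, mul_div_cancel₀ _ (by linarith : (s : ℝ) - iotaOf k s lam ≠ 0)]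

lemma isWaterLevel (h : IsSortedSpectrum k s lam) (hs : 0 < s) :
    IsWaterLevel s (fun j : Fin k => lam ((j : ℕ) + 1)) (avgTail k s lam (iotaOf k s lam)) := by
  have hsk := h.le_size
  have hιs := (h.isIota hs).1
  have hιs' : (iotaOf k s lam : ℝ) < s := by exact_mod_cast hιs
  refine ⟨h.avgTail_pos hs, ?_, fun u hu => ?_⟩
  · rw [← sum_Icc_eq_sum_fin k (fun ℓ => min (lam ℓ) (avgTail k s lam (iotaOf k s lam))),
      sum_Icc_split (hιs.le.trans hsk),
      Finset.sum_congr rfl fun ℓ hℓ => min_eq_right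
        (h.avgTail_lt hs (Finset.mem_Icc.1 hℓ).1 (Finset.mem_Icc.1 hℓ).2).le,
      Finset.sum_congr rfl fun ℓ hℓ => min_eq_left
        (h.le_avgTail hs (Finset.mem_Icc.1 hℓ).1 (Finset.mem_Icc.1 hℓ).2), h.sum_tail hs]
    simp only [Finset.sum_const, Nat.card_Icc, nsmul_eq_mul, Nat.add_sub_cancel]
    ring
  · rw [← sum_Icc_eq_sum_fin k (fun ℓ => min (lam ℓ) u), sum_Icc_split (hιs.le.trans hsk)] at hu
    have h1 := Finset.sum_le_sum fun ℓ (_ : ℓ ∈ Finset.Icc 1 (iotaOf k s lam)) =>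
      min_le_right (lam ℓ) u
    have h2 := Finset.sum_le_sum fun ℓ (_ : ℓ ∈ Finset.Icc (iotaOf k s lam + 1) k) =>
      min_le_left (lam ℓ) u
    rw [h.sum_tail hs] at h2
    simp only [Finset.sum_const, Nat.card_Icc, nsmul_eq_mul, Nat.add_sub_cancel] at h1
    refine le_of_mul_le_mul_left ?_ (sub_pos.2 hιs')
    linarith

lemma phiS_eq (h : IsSortedSpectrum k s lam) (hs : 0 < s) :
    phiS k s lam = levelLog (fun j : Fin k => lam ((j : ℕ) + 1))
      (avgTail k s lam (iotaOf k s lam)) := by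
  have ht := h.avgTail_pos hs
  have htail := h.sum_tail hs
  rw [phiS, levelLog]
  rw [← sum_Icc_eq_sum_fin k (fun ℓ => min (lam ℓ) (avgTail k s lam (iotaOf k s lam)) /
      avgTail k s lam (iotaOf k s lam) *
      Real.log (max (lam ℓ) (avgTail k s lam (iotaOf k s lam)))),
    sum_Icc_split ((h.isIota hs).1.le.trans h.le_size)]
  congr 1
  · refine Finset.sum_congr rfl fun ℓ hℓ => ?_
    have := (h.avgTail_lt hs (Finset.mem_Icc.1 hℓ).1 (Finset.mem_Icc.1 hℓ).2).le
    rw [min_eq_right this, max_eq_left this, div_self ht.ne', one_mul]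
  · rw [Finset.sum_congr rfl fun ℓ hℓ => by
      rw [min_eq_left (h.le_avgTail hs (Finset.mem_Icc.1 hℓ).1 (Finset.mem_Icc.1 hℓ).2),
        max_eq_right (h.le_avgTail hs (Finset.mem_Icc.1 hℓ).1 (Finset.mem_Icc.1 hℓ).2)],
      ← Finset.sum_mul, ← Finset.sum_div, htail, mul_div_cancel_right₀ _ ht.ne']

lemma betaOf_eq (h : IsSortedSpectrum k s lam) (hs : 0 < s) :
    betaOf k s lam =
      fun j : Fin k => (max (lam ((j : ℕ) + 1)) (avgTail k s lam (iotaOf k s lam)))⁻¹ := by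
  funext j
  have hιs' : (iotaOf k s lam : ℝ) < s := by exact_mod_cast (h.isIota hs).1
  rw [betaOf]
  split_ifs with hj
  · rw [max_eq_left (h.avgTail_lt hs (by omega) hj).le]
  · rw [max_eq_right (h.le_avgTail hs (by omega) (by omega)), h.sum_tail hs,
      div_mul_cancel_left₀ (by linarith)]

end IsSortedSpectrum

lemma eigsDesc_getElem {k : ℕ} {X : Matrix (Fin k) (Fin k) ℝ} (h : X.IsHermitian) :
    ∃ l : List ℝ, l.length = k ∧ (l : Multiset ℝ) = (List.ofFn h.eigenvalues : List ℝ) ∧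
      l.Pairwise (fun a b => b ≤ a) ∧ ∀ i, eigsDesc k X i = l.getD (i - 1) 0 := by
  refine ⟨((((List.ofFn h.eigenvalues : List ℝ) : Multiset ℝ).sort (· ≤ ·)).reverse), ?_, ?_, ?_,
    fun i => by rw [eigsDesc, dif_pos h]⟩
  · simp
  · rw [Multiset.coe_reverse, Multiset.sort_eq]
  · rw [List.pairwise_reverse]
    exact Multiset.pairwise_sort _ _

lemma sum_eigsDesc {k : ℕ} {X : Matrix (Fin k) (Fin k) ℝ} (h : X.IsHermitian) (g : ℝ → ℝ) :
    ∑ j : Fin k, g (eigsDesc k X ((j : ℕ) + 1)) = ∑ j, g (h.eigenvalues j) := by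
  obtain ⟨l, rfl, hl, -, he⟩ := eigsDesc_getElem h
  rw [← List.sum_ofFn, ← List.sum_ofFn]
  have h1 : List.ofFn (fun j : Fin l.length => g (eigsDesc _ X ((j : ℕ) + 1))) = l.map g := by
    apply List.ext_getElem <;> simp +contextual [he]
  have h2 : List.ofFn (fun j => g (h.eigenvalues j)) = (List.ofFn h.eigenvalues).map g := by
    rw [List.map_ofFn]; rfl
  rw [h1, h2]
  exact ((Multiset.coe_eq_coe.1 hl).map g).sum_eq

lemma eigsDesc_nonneg {k : ℕ} {X : Matrix (Fin k) (Fin k) ℝ} (h : X.IsHermitian)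
    (h0 : ∀ j, 0 ≤ h.eigenvalues j) (i : ℕ) : 0 ≤ eigsDesc k X i := by
  obtain ⟨l, -, hl, -, he⟩ := eigsDesc_getElem h
  rw [he]
  by_cases hi : i - 1 < l.length
  · rw [List.getD_eq_getElem _ _ hi]
    have : l[i - 1] ∈ List.ofFn h.eigenvalues :=
      (Multiset.coe_eq_coe.1 hl).subset (List.getElem_mem hi)
    obtain ⟨j, hj⟩ := (List.mem_ofFn' _ _).1 this
    exact hj ▸ h0 j
  · rw [List.getD_eq_default _ _ (by omega)]

lemma eigsDesc_anti {k : ℕ} {X : Matrix (Fin k) (Fin k) ℝ} (h : X.IsHermitian) (i j : ℕ)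
    (hi : 1 ≤ i) (hij : i ≤ j) (hj : j ≤ k) : eigsDesc k X j ≤ eigsDesc k X i := by
  obtain ⟨l, rfl, -, hp, he⟩ := eigsDesc_getElem h
  obtain rfl | hlt := hij.eq_or_lt
  · rfl
  rw [he, he, List.getD_eq_getElem _ _ (by omega), List.getD_eq_getElem _ _ (by omega)]
  exact List.pairwise_iff_getElem.1 hp _ _ _ _ (by omega)

/-- An orthogonal diagonalization, with no ordering of the eigenvalues. -/
structure IsDiagonalization {k : ℕ} (X Q : Matrix (Fin k) (Fin k) ℝ) (μ : Fin k → ℝ) : Prop where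
  mul_transpose : Q * Qᵀ = 1
  eq : X = Q * diagonal μ * Qᵀ

lemma isDiagonalization_eigenvalues {k : ℕ} {X : Matrix (Fin k) (Fin k) ℝ} (h : X.IsHermitian) :
    IsDiagonalization X h.eigenvectorUnitary h.eigenvalues := by
  refine ⟨?_, ?_⟩
  · have := Unitary.mul_star_self_of_mem h.eigenvectorUnitary.2
    rwa [star_eq_conjTranspose, conjTranspose_eq_transpose_of_trivial] at this
  · conv_lhs => rw [h.spectral_theorem, Unitary.conjStarAlgAut_apply]
    rw [star_eq_conjTranspose, conjTranspose_eq_transpose_of_trivial]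
    rfl

namespace IsDiagonalization

variable {k : ℕ} {X Y Q V : Matrix (Fin k) (Fin k) ℝ} {lam μ : Fin k → ℝ}

lemma transpose_mul (h : IsDiagonalization X Q lam) : Qᵀ * Q = 1 :=
  mul_eq_one_comm.1 h.mul_transpose

lemma conj_eq (h : IsDiagonalization X Q lam) : Qᵀ * X * Q = diagonal lam := by
  rw [h.eq, ← Matrix.mul_assoc, ← Matrix.mul_assoc, h.transpose_mul, Matrix.one_mul,
    Matrix.mul_assoc, h.transpose_mul, Matrix.mul_one]

lemma rank_eq (h : IsDiagonalization X Q lam) :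
    (X.rank : ℝ) = ∑ j, if lam j ≠ 0 then (1 : ℝ) else 0 := by
  have hQ : IsUnit Q.det :=
    (Matrix.isUnit_iff_isUnit_det _).1 (IsUnit.of_mul_eq_one _ h.mul_transpose)
  have hQ' : IsUnit Qᵀ.det := by rwa [det_transpose]
  rw [h.eq, rank_mul_eq_left_of_isUnit_det _ _ hQ', rank_mul_eq_right_of_isUnit_det _ _ hQ,
    rank_diagonal, Fintype.card_subtype, Finset.sum_boole]

/-- The squared overlaps of two orthogonal bases. -/
def overlap (Q V : Matrix (Fin k) (Fin k) ℝ) (i j : Fin k) : ℝ := ((Qᵀ * V) i j) ^ 2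

lemma overlap_nonneg (Q V : Matrix (Fin k) (Fin k) ℝ) (i j : Fin k) : 0 ≤ overlap Q V i j :=
  sq_nonneg _

lemma sum_overlap_right (hQ : Qᵀ * Q = 1) (hV : V * Vᵀ = 1) (i : Fin k) :
    ∑ j, overlap Q V i j = 1 := by
  have h : (Qᵀ * V) * (Qᵀ * V)ᵀ = 1 := by
    rw [Matrix.transpose_mul, transpose_transpose, Matrix.mul_assoc, ← Matrix.mul_assoc V, hV,
      Matrix.one_mul, hQ]
  have := congrFun (congrFun h i) i
  rw [Matrix.mul_apply, one_apply_eq] at this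
  rw [← this]
  exact Finset.sum_congr rfl fun j _ => by rw [overlap, transpose_apply, sq]

lemma overlap_comm (Q V : Matrix (Fin k) (Fin k) ℝ) (i j : Fin k) :
    overlap Q V i j = overlap V Q j i := by
  rw [overlap, overlap, ← transpose_apply (Vᵀ * Q), Matrix.transpose_mul, transpose_transpose]

lemma sum_overlap_left (hQ : Q * Qᵀ = 1) (hV : Vᵀ * V = 1) (j : Fin k) :
    ∑ i, overlap Q V i j = 1 := by
  rw [← sum_overlap_right hV hQ j]
  exact Finset.sum_congr rfl fun i _ => overlap_comm Q V i j

lemma trace_mul (Q V : Matrix (Fin k) (Fin k) ℝ) (a b : Fin k → ℝ) :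
    (Q * diagonal a * Qᵀ * (V * diagonal b * Vᵀ)).trace =
      ∑ i, ∑ j, overlap Q V i j * (a i * b j) := by
  have h : (Q * diagonal a * Qᵀ * (V * diagonal b * Vᵀ)).trace =
      ((diagonal a * (Qᵀ * V)) * (diagonal b * (Qᵀ * V)ᵀ)).trace := by
    rw [Matrix.mul_assoc Q, Matrix.mul_assoc Q, trace_mul_comm Q]
    simp only [Matrix.mul_assoc, Matrix.transpose_mul, transpose_transpose]
  rw [h, trace]
  refine Finset.sum_congr rfl fun i _ => ?_
  rw [diag_apply, Matrix.mul_apply]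
  refine Finset.sum_congr rfl fun j _ => ?_
  rw [diagonal_mul, diagonal_mul, transpose_apply, overlap]
  ring

lemma conj_apply (h : IsDiagonalization X Q lam) (j : Fin k) :
    (Vᵀ * X * V) j j = ∑ i, overlap Q V i j * lam i := by
  have h1 : Vᵀ * X * V = (Qᵀ * V)ᵀ * (diagonal lam * (Qᵀ * V)) := by
    rw [h.eq]
    simp only [Matrix.mul_assoc, Matrix.transpose_mul, transpose_transpose]
  rw [h1, Matrix.mul_apply]
  refine Finset.sum_congr rfl fun i _ => ?_
  rw [transpose_apply, diagonal_mul, overlap]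
  ring

/-- Supergradient inequality for the spectral function `levelLog`. -/
lemma levelLog_le {s : ℕ} {t τ : ℝ} (hX : IsDiagonalization X Q lam)
    (hY : IsDiagonalization Y V μ) (ht : IsWaterLevel s lam t) (hτ : IsWaterLevel s μ τ)
    (hμ : ∀ j, 0 ≤ μ j) :
    levelLog μ τ ≤ levelLog lam t +
      ∑ i, ∑ j, overlap Q V i j * ((max (lam i) t)⁻¹ * μ j) - s := by
  have key : ∀ i j, overlap Q V i j * (min (μ j) τ / τ * (1 + Real.log (max (μ j) τ) - Real.log t))
      ≤ overlap Q V i j * ((max (lam i) t)⁻¹ * μ j) +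
        overlap Q V i j * (Real.log (max (lam i) t) - Real.log t) := by
    intro i j
    rw [← mul_add]
    refine mul_le_mul_of_nonneg_left ?_ (overlap_nonneg _ _ _ _)
    have hA : 0 < max (lam i) t := lt_max_of_lt_right ht.pos
    have hM : 0 < max (μ j) τ := lt_max_of_lt_right hτ.pos
    have hp0 : 0 ≤ min (μ j) τ / τ := div_nonneg (le_min (hμ j) hτ.pos.le) hτ.pos.le
    have hp1 : min (μ j) τ / τ ≤ 1 := div_le_one_of_le₀ (min_le_right _ _) hτ.pos.le
    have hpM : μ j = min (μ j) τ / τ * max (μ j) τ := by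
      rw [div_mul_eq_mul_div, min_mul_max, mul_div_cancel_right₀ _ hτ.pos.ne']
    have hlog : Real.log t ≤ Real.log (max (lam i) t) :=
      Real.log_le_log ht.pos (le_max_right _ _)
    have htan := Real.log_le_sub_one_of_pos (div_pos hM hA)
    rw [Real.log_div hM.ne' hA.ne'] at htan
    have h1 : (max (lam i) t)⁻¹ * μ j = min (μ j) τ / τ * (max (μ j) τ / max (lam i) t) := by
      conv_lhs => rw [hpM]
      ring
    rw [h1]
    nlinarith [mul_le_mul_of_nonneg_left htan hp0,
      mul_nonneg (sub_nonneg.2 hp1) (sub_nonneg.2 hlog)]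
  have hsum := Finset.sum_le_sum fun i (_ : i ∈ Finset.univ) =>
    Finset.sum_le_sum fun j (_ : j ∈ Finset.univ) => key i j
  simp only [Finset.sum_add_distrib] at hsum
  have hL : ∑ i, ∑ j, overlap Q V i j *
      (min (μ j) τ / τ * (1 + Real.log (max (μ j) τ) - Real.log t)) =
      levelLog μ τ + s * (1 - Real.log t) := by
    rw [Finset.sum_comm]
    simp only [← Finset.sum_mul, sum_overlap_left hX.mul_transpose hY.transpose_mul, one_mul]
    have : (s : ℝ) = ∑ j, min (μ j) τ / τ := by
      rw [← Finset.sum_div, hτ.sum_min, mul_div_cancel_right₀ _ hτ.pos.ne']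
    rw [levelLog, this, Finset.sum_mul, ← Finset.sum_add_distrib]
    exact Finset.sum_congr rfl fun j _ => by ring
  have hR : ∑ i, ∑ j, overlap Q V i j * (Real.log (max (lam i) t) - Real.log t) =
      levelLog lam t - s * Real.log t := by
    simp only [← Finset.sum_mul, sum_overlap_right hX.transpose_mul hY.mul_transpose, one_mul]
    have : (s : ℝ) = ∑ j, min (lam j) t / t := by
      rw [← Finset.sum_div, ht.sum_min, mul_div_cancel_right₀ _ ht.pos.ne']
    rw [levelLog, this, Finset.sum_mul, ← Finset.sum_sub_distrib]
    refine Finset.sum_congr rfl fun i _ => ?_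
    rcases le_total (lam i) t with h | h
    · rw [max_eq_right h]; ring
    · rw [max_eq_left h, min_eq_right h, div_self ht.pos.ne']; ring
  rw [hL, hR] at hsum
  linarith

lemma sum_inv_max_mul {s : ℕ} {t : ℝ} (ht : IsWaterLevel s lam t) :
    ∑ i, (max (lam i) t)⁻¹ * lam i = s := by
  have : (s : ℝ) = ∑ j, min (lam j) t / t := by
    rw [← Finset.sum_div, ht.sum_min, mul_div_cancel_right₀ _ ht.pos.ne']
  rw [this]
  refine Finset.sum_congr rfl fun i _ => ?_
  have hA : 0 < max (lam i) t := lt_max_of_lt_right ht.pos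
  rw [inv_mul_eq_div, div_eq_div_iff hA.ne' ht.pos.ne', min_mul_max]

lemma trace_mul_self (h : IsDiagonalization X Q lam) (g : Fin k → ℝ) :
    (Q * diagonal g * Qᵀ * X).trace = ∑ i, g i * lam i := by
  rw [Matrix.mul_assoc, Matrix.mul_assoc, trace_mul_comm, Matrix.mul_assoc, h.conj_eq,
    diagonal_mul_diagonal, trace_diagonal]

lemma levelLog_le_of_eq {s : ℕ} {t τ : ℝ} (hX : IsDiagonalization X Q lam)
    (hY : IsDiagonalization X V μ) (ht : IsWaterLevel s lam t) (hτ : IsWaterLevel s μ τ)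
    (hμ : ∀ j, 0 ≤ μ j) : levelLog μ τ ≤ levelLog lam t := by
  have h := hX.levelLog_le hY ht hτ hμ
  rwa [← trace_mul, ← hY.eq, hX.trace_mul_self, sum_inv_max_mul ht, add_sub_cancel_right] at h

/-- The water level is monotone in the matrix. -/
lemma level_mono {s : ℕ} {c t τ : ℝ} (hc : 0 < c) (hX : IsDiagonalization X Q lam)
    (hY : IsDiagonalization Y V μ) (ht : IsWaterLevel s lam t) (hτ : IsWaterLevel s μ τ)
    (hle : ∀ j, c * (Vᵀ * X * V) j j ≤ (Vᵀ * Y * V) j j) : c * t ≤ τ := by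
  refine hτ.le_of_le_sum _ ?_
  have h1 : ∀ j, ∑ i, overlap Q V i j * min (c * lam i) (c * t) ≤ min (μ j) (c * t) := by
    intro j
    refine le_min ?_ ?_
    · have := hle j
      rw [hX.conj_apply, hY.conj_eq, diagonal_apply_eq, Finset.mul_sum] at this
      refine (Finset.sum_le_sum fun i _ => ?_).trans this
      rw [mul_left_comm]
      exact mul_le_mul_of_nonneg_left (min_le_left _ _) (overlap_nonneg _ _ _ _)
    · calc ∑ i, overlap Q V i j * min (c * lam i) (c * t)
          ≤ ∑ i, overlap Q V i j * (c * t) := Finset.sum_le_sum fun i _ =>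
            mul_le_mul_of_nonneg_left (min_le_right _ _) (overlap_nonneg _ _ _ _)
        _ = c * t := by
            rw [← Finset.sum_mul, sum_overlap_left hX.mul_transpose hY.transpose_mul, one_mul]
  refine le_trans (le_of_eq ?_) (Finset.sum_le_sum fun j _ => h1 j)
  rw [Finset.sum_comm]
  simp only [← Finset.sum_mul, sum_overlap_right hX.transpose_mul hY.mul_transpose, one_mul]
  simp only [← mul_min_of_nonneg _ _ hc.le, ← Finset.mul_sum, ht.sum_min]
  ring

lemma transpose_eq (h : IsDiagonalization X Q lam) : Xᵀ = X := by
  rw [h.eq]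
  simp only [Matrix.transpose_mul, transpose_transpose, diagonal_transpose, Matrix.mul_assoc]

lemma sum_overlap_sq (hX : IsDiagonalization X Q lam) (hY : IsDiagonalization Y V μ) :
    ∑ i, ∑ j, overlap Q V i j * (μ j - lam i) ^ 2 = ((Y - X) * (Y - X)).trace := by
  have hM : Qᵀ * (Y - X) * V = Qᵀ * V * diagonal μ - diagonal lam * (Qᵀ * V) := by
    rw [Matrix.mul_sub, Matrix.sub_mul, ← hX.conj_eq, ← hY.conj_eq]
    congr 1
    · rw [Matrix.mul_assoc Vᵀ, Matrix.mul_assoc Qᵀ V, ← Matrix.mul_assoc V, hY.mul_transpose,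
        Matrix.one_mul, Matrix.mul_assoc]
    · rw [Matrix.mul_assoc (Qᵀ * X) Q, ← Matrix.mul_assoc Q, hX.mul_transpose, Matrix.one_mul]
  have htr : ((Y - X) * (Y - X)).trace =
      ((Qᵀ * (Y - X) * V) * (Qᵀ * (Y - X) * V)ᵀ).trace := by
    have h1 : (Qᵀ * (Y - X) * V) * (Qᵀ * (Y - X) * V)ᵀ = Qᵀ * ((Y - X) * (Y - X) * Q) := by
      rw [Matrix.transpose_mul, Matrix.transpose_mul, transpose_transpose, transpose_sub,
        hX.transpose_eq, hY.transpose_eq, Matrix.mul_assoc _ V, ← Matrix.mul_assoc V,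
        hY.mul_transpose, Matrix.one_mul]
      simp only [Matrix.mul_assoc]
    rw [h1, trace_mul_comm Qᵀ, Matrix.mul_assoc _ Q, hX.mul_transpose, Matrix.mul_one]
  rw [htr, hM, trace]
  refine Finset.sum_congr rfl fun i _ => ?_
  rw [diag_apply, Matrix.mul_apply]
  refine Finset.sum_congr rfl fun j _ => ?_
  rw [transpose_apply, Matrix.sub_apply, mul_diagonal, diagonal_mul, overlap]
  ring

lemma inv_max_sub_mul_le {a b t τ : ℝ} (ht : 0 < t) (hτ : 0 < τ) :
    ((max a t)⁻¹ - (max b τ)⁻¹) * (b - a) ≤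
      (t * τ)⁻¹ * (3 / 2 * (b - a) ^ 2 + 1 / 2 * (t - τ) ^ 2) := by
  have hA : 0 < max a t := lt_max_of_lt_right ht
  have hB : 0 < max b τ := lt_max_of_lt_right hτ
  have h1 : |max b τ - max a t| ≤ |b - a| + |t - τ| := by
    refine (abs_max_sub_max_le_max b τ a t).trans (max_le ?_ ?_)
    · linarith [abs_nonneg (t - τ)]
    · rw [abs_sub_comm]; linarith [abs_nonneg (b - a)]
  have h2 : (max a t)⁻¹ - (max b τ)⁻¹ = (max a t * max b τ)⁻¹ * (max b τ - max a t) := by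
    field_simp
  have h3 : (max a t * max b τ)⁻¹ ≤ (t * τ)⁻¹ :=
    inv_anti₀ (mul_pos ht hτ)
      (mul_le_mul (le_max_right _ _) (le_max_right _ _) hτ.le hA.le)
  have h4 : (max b τ - max a t) * (b - a) ≤ 3 / 2 * (b - a) ^ 2 + 1 / 2 * (t - τ) ^ 2 := by
    have h5 : (max b τ - max a t) * (b - a) ≤ (|b - a| + |t - τ|) * |b - a| :=
      (le_abs_self _).trans (by rw [abs_mul]; gcongr)
    nlinarith [sq_nonneg (|b - a| - |t - τ|), sq_abs (b - a), sq_abs (t - τ)]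
  rw [h2, mul_assoc]
  exact (mul_le_mul_of_nonneg_left h4 (by positivity)).trans
    (mul_le_mul_of_nonneg_right h3 (by positivity))

/-- First order expansion of `levelLog` with a quadratic remainder. -/
lemma abs_levelLog_sub_le {s : ℕ} {t τ : ℝ} (hX : IsDiagonalization X Q lam)
    (hY : IsDiagonalization Y V μ) (ht : IsWaterLevel s lam t) (hτ : IsWaterLevel s μ τ)
    (hlam : ∀ j, 0 ≤ lam j) (hμ : ∀ j, 0 ≤ μ j) :
    |levelLog μ τ - levelLog lam t -
        (Q * diagonal (fun i => (max (lam i) t)⁻¹) * Qᵀ * (Y - X)).trace| ≤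
      (t * τ)⁻¹ * (3 / 2 * ((Y - X) * (Y - X)).trace + k / 2 * (t - τ) ^ 2) := by
  have hup := hX.levelLog_le hY ht hτ hμ
  have hlo := hY.levelLog_le hX hτ ht hlam
  have htr : (Q * diagonal (fun i => (max (lam i) t)⁻¹) * Qᵀ * (Y - X)).trace =
      ∑ i, ∑ j, overlap Q V i j * ((max (lam i) t)⁻¹ * μ j) - s := by
    rw [Matrix.mul_sub, trace_sub, hX.trace_mul_self, sum_inv_max_mul ht, ← trace_mul, ← hY.eq]
  have hrow : ∑ i, ∑ j, overlap Q V i j * ((max (lam i) t)⁻¹ * lam i) = s := by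
    simp only [← Finset.sum_mul, sum_overlap_right hX.transpose_mul hY.mul_transpose, one_mul]
    exact sum_inv_max_mul ht
  have hcol : ∑ i, ∑ j, overlap Q V i j * ((max (μ j) τ)⁻¹ * μ j) = s := by
    rw [Finset.sum_comm]
    simp only [← Finset.sum_mul, sum_overlap_left hX.mul_transpose hY.transpose_mul, one_mul]
    exact sum_inv_max_mul hτ
  have hcross : ∑ j, ∑ i, overlap V Q j i * ((max (μ j) τ)⁻¹ * lam i) =
      ∑ i, ∑ j, overlap Q V i j * ((max (μ j) τ)⁻¹ * lam i) := by
    rw [Finset.sum_comm]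
    simp only [overlap_comm V Q]
  have hsum : ∑ i, ∑ j, overlap Q V i j * (((max (lam i) t)⁻¹ - (max (μ j) τ)⁻¹) * (μ j - lam i))
      ≤ (t * τ)⁻¹ * (3 / 2 * ((Y - X) * (Y - X)).trace + k / 2 * (t - τ) ^ 2) := by
    have hk : ∑ i, ∑ j, overlap Q V i j * (1 / 2 * (t - τ) ^ 2) = k / 2 * (t - τ) ^ 2 := by
      simp only [← Finset.sum_mul, sum_overlap_right hX.transpose_mul hY.mul_transpose,
        Finset.sum_const, Finset.card_univ, Fintype.card_fin, nsmul_eq_mul]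
      ring
    rw [← sum_overlap_sq hX hY, ← hk, Finset.mul_sum, ← Finset.sum_add_distrib, Finset.mul_sum]
    refine Finset.sum_le_sum fun i _ => ?_
    rw [Finset.mul_sum, ← Finset.sum_add_distrib, Finset.mul_sum]
    refine Finset.sum_le_sum fun j _ => ?_
    refine (mul_le_mul_of_nonneg_left (inv_max_sub_mul_le ht.pos hτ.pos)
      (overlap_nonneg _ _ _ _)).trans (le_of_eq ?_)
    ring
  have hexp : ∑ i, ∑ j,
      overlap Q V i j * (((max (lam i) t)⁻¹ - (max (μ j) τ)⁻¹) * (μ j - lam i)) =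
      ∑ i, ∑ j, overlap Q V i j * ((max (lam i) t)⁻¹ * μ j) -
      ∑ i, ∑ j, overlap Q V i j * ((max (lam i) t)⁻¹ * lam i) -
      ∑ i, ∑ j, overlap Q V i j * ((max (μ j) τ)⁻¹ * μ j) +
      ∑ i, ∑ j, overlap Q V i j * ((max (μ j) τ)⁻¹ * lam i) := by
    simp only [← Finset.sum_sub_distrib, ← Finset.sum_add_distrib]
    exact Finset.sum_congr rfl fun i _ => Finset.sum_congr rfl fun j _ => by ring
  rw [hcross] at hlo
  rw [hexp, hrow, hcol] at hsum
  rw [htr, abs_le]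
  have h0 : 0 ≤ (t * τ)⁻¹ * (3 / 2 * ((Y - X) * (Y - X)).trace + k / 2 * (t - τ) ^ 2) := by
    have := ht.pos
    have := hτ.pos
    have : 0 ≤ ((Y - X) * (Y - X)).trace := by
      rw [← sum_overlap_sq hX hY]
      exact Finset.sum_nonneg fun i _ => Finset.sum_nonneg fun j _ =>
        mul_nonneg (overlap_nonneg _ _ _ _) (sq_nonneg _)
    positivity
  constructor <;> linarith

end IsDiagonalization

section FDD

variable {n k s : ℕ} {F : Matrix (Fin n) (Fin k) ℝ} {x Ψ : Fin n → ℝ}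

lemma conj_FDD_apply (F : Matrix (Fin n) (Fin k) ℝ) (x Ψ : Fin n → ℝ)
    (V : Matrix (Fin k) (Fin k) ℝ) (j : Fin k) :
    (Vᵀ * FDD n k F x Ψ * V) j j = ∑ i, Ψ i * x i * ((F * V) i j) ^ 2 := by
  have h : Vᵀ * FDD n k F x Ψ * V = (F * V)ᵀ * (diagonal (fun i => Ψ i * x i) * (F * V)) := by
    rw [FDD]
    simp only [Matrix.mul_assoc, Matrix.transpose_mul]
  rw [h, Matrix.mul_apply]
  refine Finset.sum_congr rfl fun i _ => ?_
  rw [transpose_apply, diagonal_mul]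
  ring

lemma conj_FDD_mono (hx : ∀ i, 0 ≤ x i) {Φ : Fin n → ℝ} {c : ℝ} (h : ∀ i, c * Φ i ≤ Ψ i)
    (V : Matrix (Fin k) (Fin k) ℝ) (j : Fin k) :
    c * (Vᵀ * FDD n k F x Φ * V) j j ≤ (Vᵀ * FDD n k F x Ψ * V) j j := by
  rw [conj_FDD_apply, conj_FDD_apply, Finset.mul_sum]
  refine Finset.sum_le_sum fun i _ => ?_
  rw [← mul_assoc, ← mul_assoc]
  exact mul_le_mul_of_nonneg_right (mul_le_mul_of_nonneg_right (h i) (hx i)) (sq_nonneg _)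

lemma isHermitian_FDD (F : Matrix (Fin n) (Fin k) ℝ) (x Ψ : Fin n → ℝ) :
    (FDD n k F x Ψ).IsHermitian := by
  rw [IsHermitian, conjTranspose_eq_transpose_of_trivial, FDD]
  simp only [Matrix.transpose_mul, transpose_transpose, diagonal_transpose, Matrix.mul_assoc]

lemma IsDiagonalization.nonneg_of_FDD {V : Matrix (Fin k) (Fin k) ℝ} {μ : Fin k → ℝ}
    (h : IsDiagonalization (FDD n k F x Ψ) V μ) (hx : ∀ i, 0 ≤ x i) (hΨ : ∀ i, 0 ≤ Ψ i)
    (j : Fin k) : 0 ≤ μ j := by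
  rw [← diagonal_apply_eq μ j, ← h.conj_eq, conj_FDD_apply]
  exact Finset.sum_nonneg fun i _ => mul_nonneg (mul_nonneg (hΨ i) (hx i)) (sq_nonneg _)

lemma rank_transpose_mul_diagonal_mul (F : Matrix (Fin n) (Fin k) ℝ) {d : Fin n → ℝ}
    (hd : ∀ i, 0 ≤ d i) :
    (Fᵀ * diagonal d * F).rank = (diagonal (fun i => √(d i)) * F).rank := by
  rw [← rank_transpose_mul_self (diagonal (fun i => √(d i)) * F), Matrix.transpose_mul,
    diagonal_transpose, ← Matrix.mul_assoc,
    Matrix.mul_assoc Fᵀ (diagonal fun i => √(d i)),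
    diagonal_mul_diagonal]
  simp only [Real.mul_self_sqrt (hd _)]

lemma rank_FDD (F : Matrix (Fin n) (Fin k) ℝ) (hx : ∀ i, 0 ≤ x i) (hΨ : ∀ i, 0 < Ψ i) :
    (FDD n k F x Ψ).rank = (Fᵀ * diagonal x * F).rank := by
  have hu : IsUnit (diagonal (fun i => √(Ψ i))).det := by
    rw [det_diagonal, isUnit_iff_ne_zero]
    exact Finset.prod_ne_zero_iff.2 fun i _ => (Real.sqrt_pos.2 (hΨ i)).ne'
  rw [FDD, rank_transpose_mul_diagonal_mul F fun i => mul_nonneg (hΨ i).le (hx i),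
    rank_transpose_mul_diagonal_mul F hx,
    ← rank_mul_eq_right_of_isUnit_det _ (diagonal (fun i => √(x i)) * F) hu,
    ← Matrix.mul_assoc, diagonal_mul_diagonal]
  simp only [Real.sqrt_mul (hΨ _).le]

lemma rank_transpose_mul_diagonal_mul_congr {k' : ℕ} {F' : Matrix (Fin n) (Fin k') ℝ}
    (h : F * Fᵀ = F' * F'ᵀ) (hx : ∀ i, 0 ≤ x i) :
    (Fᵀ * diagonal x * F).rank = (F'ᵀ * diagonal x * F').rank := by
  rw [rank_transpose_mul_diagonal_mul F hx, rank_transpose_mul_diagonal_mul F' hx,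
    ← rank_self_mul_transpose, ← rank_self_mul_transpose (_ * F')]
  simp only [Matrix.transpose_mul]
  rw [Matrix.mul_assoc _ F, ← Matrix.mul_assoc F, h, Matrix.mul_assoc _ F', ← Matrix.mul_assoc F']

lemma IsSpectralDecomp.isDiagonalization {Q : Matrix (Fin k) (Fin k) ℝ} {lam : ℕ → ℝ}
    (h : IsSpectralDecomp n k F x Ψ Q lam) :
    IsDiagonalization (FDD n k F x Ψ) Q (fun j : Fin k => lam ((j : ℕ) + 1)) :=
  ⟨h.1, h.2.1⟩

lemma IsSpectralDecomp.isSortedSpectrum {Q : Matrix (Fin k) (Fin k) ℝ} {lam : ℕ → ℝ}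
    (h : IsSpectralDecomp n k F x Ψ Q lam) (hx : ∀ i, 0 ≤ x i) (hΨ : ∀ i, 0 < Ψ i)
    (hr : s ≤ (Fᵀ * diagonal x * F).rank) : IsSortedSpectrum k s lam := by
  refine ⟨h.2.2.1, h.2.2.2, ?_⟩
  rw [← h.isDiagonalization.rank_eq, rank_FDD F hx hΨ]
  exact_mod_cast hr

lemma exists_gammaS_FDD_eq_levelLog (hs : 0 < s) (hx : ∀ i, 0 ≤ x i) (hΨ : ∀ i, 0 < Ψ i)
    (hr : s ≤ (Fᵀ * diagonal x * F).rank) :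
    ∃ V μ τ, IsDiagonalization (FDD n k F x Ψ) V μ ∧ (∀ j, 0 ≤ μ j) ∧ IsWaterLevel s μ τ ∧
      gammaS k s (FDD n k F x Ψ) = levelLog μ τ := by
  have hH := isHermitian_FDD F x Ψ
  have hD := isDiagonalization_eigenvalues hH
  have h0 := hD.nonneg_of_FDD hx fun i => (hΨ i).le
  have hS : IsSortedSpectrum k s (eigsDesc k (FDD n k F x Ψ)) := by
    refine ⟨eigsDesc_nonneg hH h0, eigsDesc_anti hH, ?_⟩
    rw [sum_eigsDesc hH (fun a => if a ≠ 0 then (1 : ℝ) else 0), ← hD.rank_eq, rank_FDD F hx hΨ]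
    exact_mod_cast hr
  have hW := hS.isWaterLevel hs
  refine ⟨_, _, _, hD, h0, ⟨hW.pos, ?_, fun u hu => hW.le_of_le_sum u ?_⟩, ?_⟩
  · rw [← sum_eigsDesc hH (fun a => min a _)]
    exact hW.sum_min
  · rwa [sum_eigsDesc hH (fun a => min a u)]
  · rw [gammaS, hS.phiS_eq hs, levelLog, levelLog]
    exact sum_eigsDesc hH fun a => min a _ / _ * Real.log (max a _)

lemma FDD_sub (F : Matrix (Fin n) (Fin k) ℝ) (x Ψ Φ : Fin n → ℝ) :
    FDD n k F x Ψ - FDD n k F x Φ = FDD n k F x (Ψ - Φ) := by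
  rw [FDD, FDD, FDD, ← Matrix.sub_mul, ← Matrix.mul_sub, diagonal_sub]
  simp only [Pi.sub_apply, sub_mul]

lemma exists_trace_FDD_sq_le (F : Matrix (Fin n) (Fin k) ℝ) (x : Fin n → ℝ) :
    ∃ K : ℝ, 0 ≤ K ∧ ∀ d, (FDD n k F x d * FDD n k F x d).trace ≤ K * ‖d‖ ^ 2 := by
  refine ⟨∑ a, ∑ b, (∑ i, |F i a * x i * F i b|) * (∑ i, |F i b * x i * F i a|),
    by positivity, fun d => ?_⟩
  have hentry : ∀ a b, |FDD n k F x d a b| ≤ ‖d‖ * ∑ i, |F i a * x i * F i b| := by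
    intro a b
    rw [FDD, Matrix.mul_apply, Finset.mul_sum]
    refine (Finset.abs_sum_le_sum_abs _ _).trans (Finset.sum_le_sum fun i _ => ?_)
    rw [mul_diagonal, transpose_apply,
      show F i a * (d i * x i) * F i b = d i * (F i a * x i * F i b) by ring, abs_mul]
    exact mul_le_mul_of_nonneg_right (norm_le_pi_norm d i) (abs_nonneg _)
  rw [trace, Finset.sum_mul]
  refine Finset.sum_le_sum fun a _ => ?_
  rw [diag_apply, Matrix.mul_apply, Finset.sum_mul]
  refine Finset.sum_le_sum fun b _ => ?_
  calc FDD n k F x d a b * FDD n k F x d b a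
      ≤ |FDD n k F x d a b| * |FDD n k F x d b a| := by rw [← abs_mul]; exact le_abs_self _
    _ ≤ (‖d‖ * ∑ i, |F i a * x i * F i b|) * (‖d‖ * ∑ i, |F i b * x i * F i a|) :=
        mul_le_mul (hentry a b) (hentry b a) (abs_nonneg _) (by positivity)
    _ = _ := by ring

lemma trace_mul_FDD (F : Matrix (Fin n) (Fin k) ℝ) (x d : Fin n → ℝ)
    (G : Matrix (Fin k) (Fin k) ℝ) :
    (G * FDD n k F x d).trace = ∑ i, d i * (x i * (F * G * Fᵀ) i i) := by
  rw [FDD, ← Matrix.mul_assoc, trace_mul_comm, ← Matrix.mul_assoc, ← Matrix.mul_assoc, trace]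
  refine Finset.sum_congr rfl fun i _ => ?_
  rw [diag_apply, mul_diagonal]
  ring

/-- Multiplicative comparison of two positive vectors at distance small relative to `m`. -/
lemma one_sub_norm_div_mul_le {m : ℝ} (hm : 0 < m) {Φ : Fin n → ℝ} (hΨ : ∀ i, m ≤ Ψ i)
    (i : Fin n) : (1 - ‖Ψ - Φ‖ / m) * Ψ i ≤ Φ i := by
  have h1 : Ψ i - Φ i ≤ ‖Ψ - Φ‖ := (le_abs_self _).trans (norm_le_pi_norm (Ψ - Φ) i)
  have h2 : ‖Ψ - Φ‖ ≤ ‖Ψ - Φ‖ / m * Ψ i := by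
    rw [div_mul_eq_mul_div, le_div_iff₀ hm]
    exact mul_le_mul_of_nonneg_left (hΨ i) (norm_nonneg _)
  linarith

open Asymptotics in
lemma isBigO_gammaS_FDD {Υ : Fin n → ℝ} (hs : 0 < s) (hx : ∀ i, 0 ≤ x i) (hΥ : ∀ i, 0 < Υ i)
    (hr : s ≤ (Fᵀ * diagonal x * F).rank) {Q : Matrix (Fin k) (Fin k) ℝ} {lam : ℕ → ℝ}
    (hdec : IsSpectralDecomp n k F x Υ Q lam) :
    (fun Ψ => gammaS k s (FDD n k F x Ψ) - gammaS k s (FDD n k F x Υ) -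
      ∑ i, (Ψ - Υ) i * (x i * gMat n k s F Q lam i i)) =O[nhds Υ] fun Ψ => ‖Ψ - Υ‖ ^ 2 := by
  have hX := hdec.isDiagonalization
  have hS := hdec.isSortedSpectrum hx hΥ hr
  have ht := hS.isWaterLevel hs
  have hlam := fun j : Fin k => hS.nonneg ((j : ℕ) + 1)
  have hβ := hS.betaOf_eq hs
  set t := avgTail k s lam (iotaOf k s lam)
  have htpos := ht.pos
  obtain ⟨m, hm, hmΥ⟩ : ∃ m : ℝ, 0 < m ∧ ∀ i, 2 * m ≤ Υ i := by
    rcases isEmpty_or_nonempty (Fin n) with h | h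
    · exact ⟨1, one_pos, fun i => h.elim i⟩
    · obtain ⟨i₀, hi₀⟩ := Finite.exists_min Υ
      exact ⟨Υ i₀ / 2, half_pos (hΥ i₀), fun i => by linarith [hi₀ i]⟩
  obtain ⟨K, hK0, hK⟩ := exists_trace_FDD_sq_le F x
  have hbase : gammaS k s (FDD n k F x Υ) = levelLog (fun j : Fin k => lam ((j : ℕ) + 1)) t := by
    obtain ⟨V, μ, τ, hY, hμ, hτ, hval⟩ := exists_gammaS_FDD_eq_levelLog hs hx hΥ hr
    rw [hval]
    exact le_antisymm (hX.levelLog_le_of_eq hY ht hτ hμ) (hY.levelLog_le_of_eq hX hτ ht hlam)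
  refine IsBigO.of_bound (2 / t ^ 2 * (3 / 2 * K + 2 * k * t ^ 2 / m ^ 2)) ?_
  filter_upwards [Metric.ball_mem_nhds Υ (half_pos hm)] with Ψ hΨ
  rw [Metric.mem_ball, dist_eq_norm] at hΨ
  have hΨm : ∀ i, m ≤ Ψ i := fun i => by
    have := (neg_abs_le _).trans' (neg_le_neg (norm_le_pi_norm (Ψ - Υ) i))
    simp only [Pi.sub_apply] at this
    linarith [hmΥ i]
  obtain ⟨V, μ, τ, hY, hμ, hτ, hval⟩ :=
    exists_gammaS_FDD_eq_levelLog hs hx (fun i => hm.trans_le (hΨm i)) hr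
  set ε := ‖Ψ - Υ‖ / m with hε
  have hε2 : ε < 1 / 2 := by rw [hε, div_lt_iff₀ hm]; linarith
  have hε0 : 0 ≤ ε := by positivity
  have hlow : (1 - ε) * t ≤ τ := by
    refine hX.level_mono (by linarith) hY ht hτ (conj_FDD_mono hx (fun i => ?_) V)
    rw [hε, norm_sub_rev]
    exact one_sub_norm_div_mul_le hm (fun i => by linarith [hmΥ i]) i
  have hupp : (1 - ε) * τ ≤ t :=
    hY.level_mono (by linarith) hX hτ ht
      (conj_FDD_mono hx (one_sub_norm_div_mul_le hm hΨm) Q)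
  have hτpos := hτ.pos
  have hτ2 : τ ≤ 2 * t := by nlinarith
  have hτ1 : t / 2 ≤ τ := by nlinarith
  have hdiff : (t - τ) ^ 2 ≤ 4 * t ^ 2 * ε ^ 2 := by
    have : |t - τ| ≤ 2 * t * ε := abs_le.2 ⟨by nlinarith, by nlinarith⟩
    calc (t - τ) ^ 2 = |t - τ| ^ 2 := (sq_abs _).symm
      _ ≤ (2 * t * ε) ^ 2 := by gcongr
      _ = _ := by ring
  have hmain := hX.abs_levelLog_sub_le hY ht hτ hlam hμ
  rw [FDD_sub, trace_mul_FDD] at hmain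
  have hg : F * (Q * diagonal (fun j : Fin k => (max (lam ((j : ℕ) + 1)) t)⁻¹) * Qᵀ) * Fᵀ =
      gMat n k s F Q lam := by
    rw [gMat, hβ]
    simp only [Matrix.mul_assoc]
  rw [hg] at hmain
  rw [hval, hbase, Real.norm_eq_abs, Real.norm_of_nonneg (by positivity)]
  refine hmain.trans ?_
  have hinv : (t * τ)⁻¹ ≤ 2 / t ^ 2 := by
    rw [inv_le_comm₀ (by positivity) (by positivity), inv_div]
    nlinarith
  calc (t * τ)⁻¹ * (3 / 2 * (FDD n k F x (Ψ - Υ) * FDD n k F x (Ψ - Υ)).trace +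
        k / 2 * (t - τ) ^ 2)
      ≤ (t * τ)⁻¹ * (3 / 2 * (K * ‖Ψ - Υ‖ ^ 2) + k / 2 * (4 * t ^ 2 * ε ^ 2)) := by
        gcongr
        exact hK _
    _ ≤ 2 / t ^ 2 * (3 / 2 * (K * ‖Ψ - Υ‖ ^ 2) + k / 2 * (4 * t ^ 2 * ε ^ 2)) := by
        gcongr
    _ = _ := by
        rw [hε]
        field_simp
        ring

/-- `F Q Diag(g(λ)) Qᵀ Fᵀ` depends on `F` only through `F Fᵀ`. -/
lemma mul_diagonal_comp_congr {k' : ℕ} {F' : Matrix (Fin n) (Fin k') ℝ}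
    (h : F * Fᵀ = F' * F'ᵀ) {Q : Matrix (Fin k) (Fin k) ℝ} {Q' : Matrix (Fin k') (Fin k') ℝ}
    {lam : Fin k → ℝ} {lam' : Fin k' → ℝ} (hX : IsDiagonalization (FDD n k F x Ψ) Q lam)
    (hX' : IsDiagonalization (FDD n k' F' x Ψ) Q' lam') (g : ℝ → ℝ) :
    F * Q * diagonal (fun j => g (lam j)) * Qᵀ * Fᵀ =
      F' * Q' * diagonal (fun j => g (lam' j)) * Q'ᵀ * F'ᵀ := by
  set D := diagonal (fun i => Ψ i * x i) with hD
  obtain ⟨A, hA⟩ : ∃ A, A = F * Q := ⟨_, rfl⟩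
  obtain ⟨B, hB⟩ : ∃ B, B = F' * Q' := ⟨_, rfl⟩
  have hAA : A * Aᵀ = F * Fᵀ := by
    rw [hA, Matrix.transpose_mul, Matrix.mul_assoc, ← Matrix.mul_assoc Q, hX.mul_transpose,
      Matrix.one_mul]
  have hAB : A * Aᵀ = B * Bᵀ := by
    rw [hAA, h, hB, Matrix.transpose_mul, Matrix.mul_assoc F', ← Matrix.mul_assoc Q',
      hX'.mul_transpose, Matrix.one_mul]
  have hlamA : Aᵀ * D * A = diagonal lam := by
    rw [← hX.conj_eq, hA, FDD, Matrix.transpose_mul]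
    simp only [Matrix.mul_assoc, hD]
  have hlamB : Bᵀ * D * B = diagonal lam' := by
    rw [← hX'.conj_eq, hB, FDD, Matrix.transpose_mul]
    simp only [Matrix.mul_assoc, hD]
  have hcomm : diagonal lam * (Aᵀ * D * B) = Aᵀ * D * B * diagonal lam' := by
    rw [← hlamA, ← hlamB]
    have e1 : Aᵀ * D * A * (Aᵀ * D * B) = Aᵀ * D * (A * Aᵀ) * D * B := by
      simp only [Matrix.mul_assoc]
    rw [e1, hAB]
    simp only [Matrix.mul_assoc]
  have hcomm' : ∀ q : ℝ → ℝ, diagonal (fun j => q (lam j)) * (Aᵀ * D * B) =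
      Aᵀ * D * B * diagonal (fun j => q (lam' j)) := by
    intro q
    ext i j
    have := congrFun (congrFun hcomm i) j
    rw [diagonal_mul, mul_diagonal] at this ⊢
    by_cases hij : lam i = lam' j
    · rw [hij, mul_comm]
    · have h0 : (lam i - lam' j) * (Aᵀ * D * B) i j = 0 := by linarith
      rw [(mul_eq_zero.1 h0).resolve_left (sub_ne_zero.2 hij), mul_zero, zero_mul]
  have hmulB : ∀ q : ℝ → ℝ, A * diagonal (fun j => q (lam j)) * Aᵀ * D * B =
      B * diagonal (fun j => q (lam' j)) * Bᵀ * D * B := by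
    intro q
    have e1 : A * diagonal (fun j => q (lam j)) * Aᵀ * D * B =
        A * Aᵀ * (D * B * diagonal (fun j => q (lam' j))) := by
      have := congrArg (A * ·) (hcomm' q)
      simpa only [Matrix.mul_assoc] using this
    have e2 : diagonal (fun j => q (lam' j)) * (Bᵀ * D * B) =
        Bᵀ * D * B * diagonal (fun j => q (lam' j)) := by
      rw [hlamB, diagonal_mul_diagonal, diagonal_mul_diagonal]
      simp only [mul_comm]
    have e3 := congrArg (B * ·) e2
    rw [e1, hAB]
    simpa only [Matrix.mul_assoc] using e3.symm
  have hexpand : ∀ {p : ℕ} (E : Matrix (Fin n) (Fin p) ℝ) (ν : Fin p → ℝ),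
      Eᵀ * D * E = diagonal ν → E * diagonal (fun j => g (ν j)) * Eᵀ =
        g 0 • (E * Eᵀ) + E * diagonal (fun j => (g (ν j) - g 0) / ν j) * Eᵀ * D * (E * Eᵀ) := by
    intro p E ν hE
    have e1 : diagonal (fun j => g (ν j)) =
        g 0 • (1 : Matrix (Fin p) (Fin p) ℝ) +
          diagonal (fun j => (g (ν j) - g 0) / ν j) * diagonal ν := by
      rw [diagonal_mul_diagonal, ← diagonal_one, ← diagonal_smul, diagonal_add]
      congr 1
      funext j
      by_cases hj : ν j = 0
      · simp [hj]
      · simp [hj]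
    rw [e1, ← hE, Matrix.mul_add, Matrix.add_mul, Matrix.mul_smul, Matrix.smul_mul, Matrix.mul_one]
    simp only [Matrix.mul_assoc]
  have hFA : F * Q * diagonal (fun j => g (lam j)) * Qᵀ * Fᵀ =
      A * diagonal (fun j => g (lam j)) * Aᵀ := by
    rw [hA, Matrix.transpose_mul, Matrix.mul_assoc _ Qᵀ]
  have hFB : F' * Q' * diagonal (fun j => g (lam' j)) * Q'ᵀ * F'ᵀ =
      B * diagonal (fun j => g (lam' j)) * Bᵀ := by
    rw [hB, Matrix.transpose_mul, Matrix.mul_assoc _ Q'ᵀ]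
  rw [hFA, hFB, hexpand A lam hlamA, hexpand B lam' hlamB, hAB, ← Matrix.mul_assoc _ B,
    hmulB (fun a => (g a - g 0) / a), ← Matrix.mul_assoc _ B]

/-- Symmetric sums of eigenvalues vanishing at zero depend on `F` only through `F Fᵀ`. -/
lemma sum_comp_congr {k' : ℕ} {F' : Matrix (Fin n) (Fin k') ℝ}
    (h : F * Fᵀ = F' * F'ᵀ) {Q : Matrix (Fin k) (Fin k) ℝ} {Q' : Matrix (Fin k') (Fin k') ℝ}
    {lam : Fin k → ℝ} {lam' : Fin k' → ℝ} (hX : IsDiagonalization (FDD n k F x Ψ) Q lam)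
    (hX' : IsDiagonalization (FDD n k' F' x Ψ) Q' lam') {g : ℝ → ℝ} (hg : g 0 = 0) :
    ∑ j, g (lam j) = ∑ j, g (lam' j) := by
  have key : ∀ {p : ℕ} {E : Matrix (Fin n) (Fin p) ℝ} {P : Matrix (Fin p) (Fin p) ℝ}
      {ν : Fin p → ℝ}, IsDiagonalization (FDD n p E x Ψ) P ν →
      ∑ j, g (ν j) = ∑ i, Ψ i * (x i *
        (E * P * diagonal (fun j => (fun a => g a / a) (ν j)) * Pᵀ * Eᵀ) i i) := by
    intro p E P ν hE
    have e1 := hE.trace_mul_self (fun j => g (ν j) / ν j)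
    rw [trace_mul_FDD] at e1
    simp only [Matrix.mul_assoc] at e1 ⊢
    rw [e1]
    refine Finset.sum_congr rfl fun j _ => ?_
    by_cases hj : ν j = 0
    · simp [hj, hg]
    · rw [div_mul_cancel₀ _ hj]
  rw [key hX, key hX', mul_diagonal_comp_congr h hX hX' fun a => g a / a]

lemma gMat_congr {k' : ℕ} {F' : Matrix (Fin n) (Fin k') ℝ} (h : F * Fᵀ = F' * F'ᵀ)
    (hs : 0 < s) (hx : ∀ i, 0 ≤ x i) (hΨ : ∀ i, 0 < Ψ i) (hr : s ≤ (Fᵀ * diagonal x * F).rank)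
    {Q : Matrix (Fin k) (Fin k) ℝ} {Q' : Matrix (Fin k') (Fin k') ℝ} {lam lam' : ℕ → ℝ}
    (hX : IsSpectralDecomp n k F x Ψ Q lam) (hX' : IsSpectralDecomp n k' F' x Ψ Q' lam') :
    gMat n k s F Q lam = gMat n k' s F' Q' lam' := by
  have hS := hX.isSortedSpectrum hx hΨ hr
  have hS' := hX'.isSortedSpectrum hx hΨ (rank_transpose_mul_diagonal_mul_congr h hx ▸ hr)
  have hW := hS.isWaterLevel hs
  have hW' := hS'.isWaterLevel hs
  have hsum : ∀ u, 0 ≤ u → ∑ j : Fin k, min (lam ((j : ℕ) + 1)) u =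
      ∑ j : Fin k', min (lam' ((j : ℕ) + 1)) u := fun u hu =>
    sum_comp_congr h hX.isDiagonalization hX'.isDiagonalization
      (g := fun a => min a u) (min_eq_left hu)
  have ht : avgTail k s lam (iotaOf k s lam) = avgTail k' s lam' (iotaOf k' s lam') :=
    le_antisymm (hW'.le_of_le_sum _ (by rw [← hsum _ hW.pos.le, hW.sum_min]))
      (hW.le_of_le_sum _ (by rw [hsum _ hW'.pos.le, hW'.sum_min]))
  rw [gMat, gMat, hS.betaOf_eq hs, hS'.betaOf_eq hs, ht]
  exact mul_diagonal_comp_congr h hX.isDiagonalization hX'.isDiagonalization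
    fun a => (max a (avgTail k' s lam' (iotaOf k' s lam')))⁻¹

end FDD

/-- Theorem 3.iv (first part): for fixed `x ≥ 0` with `rank(Fᵀ Diag(x) F) ≥ s`, the map
`Υ ↦ f_DDFact(x;Υ)` is differentiable at every `Υ ∈ ℝⁿ₊₊` with gradient
`g_Υ(x;Υ) = x ∘ diag(F Q Diag(β) Qᵀ Fᵀ) − Diag(Υ)⁻¹ x`; moreover the gradient is
invariant to the choices of `F` and `Q` (with `β` adjusted accordingly). -/
theorem stmt_12 (n k s r : ℕ) (hn : 1 < n) (hs0 : 0 < s) (hsn : s < n)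
    (C : Matrix (Fin n) (Fin n) ℝ) (hC : C.PosSemidef)
    (hr : C.rank = r) (hrs : s ≤ r)
    (F : Matrix (Fin n) (Fin k) ℝ) (hF : C = F * Fᵀ) (hk1 : r ≤ k) (hk2 : k ≤ n)
    (x : Fin n → ℝ) (hx0 : ∀ i, 0 ≤ x i)
    (hxr : s ≤ (Fᵀ * Matrix.diagonal x * F).rank)
    (Υ : Fin n → ℝ) (hΥ : ∀ i, 0 < Υ i)
    (Q : Matrix (Fin k) (Fin k) ℝ) (lam : ℕ → ℝ)
    (hdec : IsSpectralDecomp n k F x Υ Q lam) :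
    HasFDerivAt (fun Ψ : Fin n → ℝ => fDD n k s F x Ψ)
      (∑ i, (x i * (gMat n k s F Q lam) i i - x i / Υ i) •
        (ContinuousLinearMap.proj i : (Fin n → ℝ) →L[ℝ] ℝ)) Υ ∧
    (∀ (k' : ℕ) (F' : Matrix (Fin n) (Fin k') ℝ) (Q' : Matrix (Fin k') (Fin k') ℝ)
        (lam' : ℕ → ℝ), C = F' * F'ᵀ → r ≤ k' → k' ≤ n →
        IsSpectralDecomp n k' F' x Υ Q' lam' →
        ∀ i, (gMat n k s F Q lam) i i = (gMat n k' s F' Q' lam') i i) := by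
  refine ⟨?_, fun k' F' Q' lam' hF' _ _ hdec' i => ?_⟩
  · have hgamma : HasFDerivAt (fun Ψ => gammaS k s (FDD n k F x Ψ))
        (∑ i, (x i * gMat n k s F Q lam i i) •
          (ContinuousLinearMap.proj i : (Fin n → ℝ) →L[ℝ] ℝ)) Υ := by
      have h1 := (isBigO_gammaS_FDD hs0 hx0 hΥ hxr hdec).hasFDerivAt (𝕜 := ℝ) one_lt_two
      have h2 := (∑ i, (x i * gMat n k s F Q lam i i) • ContinuousLinearMap.proj i :
        (Fin n → ℝ) →L[ℝ] ℝ).hasFDerivAt (x := Υ)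
      have h3 := (h1.add h2).add_const (gammaS k s (FDD n k F x Υ) -
        ∑ i, Υ i * (x i * gMat n k s F Q lam i i))
      rw [zero_add] at h3
      refine h3.congr_of_eventuallyEq (Filter.Eventually.of_forall fun Ψ => ?_)
      simp only [Pi.add_apply, _root_.sum_apply, _root_.smul_apply,
        ContinuousLinearMap.proj_apply, smul_eq_mul, Pi.sub_apply, sub_mul,
        Finset.sum_sub_distrib, mul_comm (x _ * _) (Ψ _)]
      ring
    have hlog : HasFDerivAt (fun Ψ : Fin n → ℝ => ∑ i, x i * Real.log (Ψ i))
        (∑ i, (x i / Υ i) • (ContinuousLinearMap.proj i : (Fin n → ℝ) →L[ℝ] ℝ)) Υ := by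
      refine HasFDerivAt.fun_sum fun i _ => ?_
      have h1 := (((ContinuousLinearMap.proj i : (Fin n → ℝ) →L[ℝ] ℝ).hasFDerivAt
        (x := Υ)).log (hΥ i).ne').const_mul (x i)
      rwa [smul_smul, ← div_eq_mul_inv] at h1
    have h := hgamma.sub hlog
    rw [← Finset.sum_sub_distrib] at h
    simp only [← sub_smul] at h
    exact h
  · rw [gMat_congr (hF.symm.trans hF') hs0 hx0 hΥ hxr hdec hdec']

end
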